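/- arXiv:2602.17069 — 2 statements merged into one kernel-verified Lean document; each statement's English description precedes it below -/
import Mathlib

section
/- Let n ≥ 1, s ∈ (0,1), and suppose u ∈ C²(ℝⁿ) ∩ L_{2s} attains its global maximum over ℝⁿ at a point x̃. Then for every r > 0 one has (C₀/C_{n,s})·r^{2s}·[(−Δ)^s u(x̃) − Δu(x̃)] + C₀·r^{2s}·∫_{ℝⁿ∖B_r(x̃)} u(y)/|x̃−y|^{n+2s} dy ≥ u(x̃), where C₀ = (∫_{ℝⁿ∖B₁(0)} |y|^{−(n+2s)} dy)^{−1} > 0 and C₀·r^{2s}·∫_{ℝⁿ∖B_r(x̃)} |x̃−y|^{−(n+2s)} dy = 1. -/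
open MeasureTheory Filter Set

noncomputable section

/-- `ℝⁿ` as a Euclidean space. -/
abbrev En (n : ℕ) : Type := EuclideanSpace ℝ (Fin n)

/-- `HasFracLap n s Cns u x L` says that the principal value defining the fractional
Laplacian `(-Δ)ˢ u (x) = Cns · P.V. ∫ (u x - u y)/|x-y|^{n+2s} dy` exists and equals `L`. -/
def HasFracLap (n : ℕ) (s Cns : ℝ) (u : En n → ℝ) (x : En n) (L : ℝ) : Prop :=
  Tendsto
    (fun ε : ℝ =>
      Cns * ∫ y in {y : En n | ε ≤ ‖x - y‖}, (u x - u y) / ‖x - y‖ ^ ((n : ℝ) + 2 * s))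
    (nhdsWithin 0 (Set.Ioi 0)) (nhds L)

/-- The classical Laplacian `Δu(x) = ∑ ∂²u/∂xᵢ²`. -/
def lap {n : ℕ} (u : En n → ℝ) (x : En n) : ℝ :=
  ∑ i : Fin n, iteratedFDeriv ℝ 2 u x fun _ => EuclideanSpace.single i (1 : ℝ)

/-- Membership in the tail space `L_{2s}`. -/
def MemL2s (n : ℕ) (s : ℝ) (u : En n → ℝ) : Prop :=
  LocallyIntegrable u volume ∧
    Integrable (fun x : En n => u x / (1 + ‖x‖ ^ ((n : ℝ) + 2 * s))) volume

/-- The Marchaud fractional time derivative of order `α ∈ (0,1)`; for `α = 1` it is the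
classical derivative. -/
def marchaud (α : ℝ) (v : ℝ → ℝ) (t : ℝ) : ℝ :=
  if α = 1 then deriv v t
  else (α / Real.Gamma (1 - α)) * ∫ τ in Set.Iio t, (v t - v τ) / (t - τ) ^ (1 + α)

/-- Membership in the space `𝓛⁻_α(ℝ)`. -/
def MemLminus (α : ℝ) (v : ℝ → ℝ) : Prop :=
  LocallyIntegrable v volume ∧
    ∀ t : ℝ, IntegrableOn (fun τ : ℝ => v τ / (1 + |τ| ^ (1 + α))) (Set.Iio t) volume

/-- Width of a set in the direction of the coordinate `i₀`. -/
def widthLast {n : ℕ} (i₀ : Fin n) (Ω : Set (En n)) : ℝ :=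
  sSup ((fun x : En n => x i₀) '' Ω) - sInf ((fun x : En n => x i₀) '' Ω)

/-- The unit vector in the direction of the coordinate `i₀`. -/
def eDir {n : ℕ} (i₀ : Fin n) : En n := EuclideanSpace.single i₀ (1 : ℝ)

theorem continuousOn_one_div_norm_rpow {n : ℕ} (x : En n) (p : ℝ) {r : ℝ} (hr : 0 < r) :
    ContinuousOn (fun y : En n => 1 / ‖x - y‖ ^ p) {y : En n | r ≤ ‖x - y‖} := by
  have hpos : ∀ y ∈ {y : En n | r ≤ ‖x - y‖}, 0 < ‖x - y‖ := fun y hy => hr.trans_le hy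
  refine continuousOn_const.div ?_ fun y hy => (Real.rpow_pos_of_pos (hpos y hy) p).ne'
  exact (by fun_prop : Continuous fun y : En n => ‖x - y‖).continuousOn.rpow_const
    fun y hy => Or.inl (hpos y hy).ne'

theorem measurableSet_le_norm_sub {n : ℕ} (x : En n) (r : ℝ) :
    MeasurableSet {y : En n | r ≤ ‖x - y‖} :=
  (isClosed_le continuous_const (by fun_prop)).measurableSet

/-- The weight `1 + |y|^p` is controlled by `|x - y|^p` away from `x`. -/
theorem one_add_norm_rpow_div_le {n : ℕ} (x y : En n) {p r : ℝ} (hp : 0 ≤ p) (hr : 0 < r)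
    (hy : r ≤ ‖x - y‖) :
    (1 + ‖y‖ ^ p) / ‖x - y‖ ^ p ≤ (1 / r) ^ p + (‖x‖ / r + 1) ^ p := by
  have hpos : 0 < ‖x - y‖ := hr.trans_le hy
  have hone : 1 ≤ ‖x - y‖ / r := (one_le_div hr).2 hy
  have hbound : ‖y‖ ≤ (‖x‖ / r + 1) * ‖x - y‖ := by
    have h1 : ‖y‖ ≤ ‖x‖ + ‖x - y‖ := by
      simpa using norm_sub_le x (x - y)
    have h2 : ‖x‖ * 1 ≤ ‖x‖ * (‖x - y‖ / r) :=
      mul_le_mul_of_nonneg_left hone (norm_nonneg x)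
    calc ‖y‖ ≤ ‖x‖ * (‖x - y‖ / r) + ‖x - y‖ := by linarith
      _ = _ := by ring
  rw [div_le_iff₀ (Real.rpow_pos_of_pos hpos p), add_mul,
    ← Real.mul_rpow (by positivity) hpos.le, ← Real.mul_rpow (by positivity) hpos.le]
  refine add_le_add (Real.one_le_rpow ?_ hp) (Real.rpow_le_rpow (norm_nonneg y) hbound hp)
  rwa [one_div_mul_eq_div]

theorem MemL2s.integrableOn_div_norm_rpow {n : ℕ} {s : ℝ} {u : En n → ℝ} (hu : MemL2s n s u)
    (hs : 0 < s) (x : En n) {r : ℝ} (hr : 0 < r) :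
    IntegrableOn (fun y : En n => u y / ‖x - y‖ ^ ((n : ℝ) + 2 * s)) {y | r ≤ ‖x - y‖} := by
  set p : ℝ := (n : ℝ) + 2 * s
  have hp : 0 ≤ p := by positivity
  have hmeas := measurableSet_le_norm_sub x r
  have hw : Continuous fun y : En n => 1 + ‖y‖ ^ p :=
    continuous_const.add (continuous_norm.rpow_const fun _ => Or.inr hp)
  have hprod := (hu.2.integrableOn (s := {y : En n | r ≤ ‖x - y‖})).bdd_mul
    (f := fun y => (1 + ‖y‖ ^ p) / ‖x - y‖ ^ p) (c := (1 / r) ^ p + (‖x‖ / r + 1) ^ p)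
    (((hw.continuousOn.mul (continuousOn_one_div_norm_rpow x p hr)).congr
      fun y _ => by simp [div_eq_mul_inv]).aestronglyMeasurable hmeas)
    (by
      filter_upwards [ae_restrict_mem hmeas] with y hy
      rw [Real.norm_of_nonneg (by positivity)]
      exact one_add_norm_rpow_div_le x y hp hr hy)
  refine IntegrableOn.congr_fun hprod (fun y _ => ?_) hmeas
  have : 1 + ‖y‖ ^ p ≠ 0 := by positivity
  change (1 + ‖y‖ ^ p) / ‖x - y‖ ^ p * (u y / (1 + ‖y‖ ^ p)) = _
  field_simp

theorem memL2s_one {n : ℕ} {s : ℝ} (hs : 0 < s) : MemL2s n s fun _ => 1 := by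
  refine ⟨continuous_const.locallyIntegrable, ?_⟩
  set p : ℝ := (n : ℝ) + 2 * s
  have hp : 0 ≤ p := by positivity
  have hw : Continuous fun y : En n => 1 + ‖y‖ ^ p :=
    continuous_const.add (continuous_norm.rpow_const fun _ => Or.inr hp)
  have hint : Integrable (fun y : En n => 2 ^ p * (1 + ‖y‖) ^ (-p)) :=
    (integrable_one_add_norm (by simp [p, hs])).const_mul _
  refine hint.mono' (continuous_const.div hw fun y => by positivity).aestronglyMeasurable
    (Eventually.of_forall fun y => ?_)
  rw [Real.norm_of_nonneg (by positivity), Real.rpow_neg (by positivity), ← div_eq_mul_inv,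
    div_le_div_iff₀ (by positivity) (by positivity), one_mul]
  rcases le_total ‖y‖ 1 with h | h
  · calc (1 + ‖y‖) ^ p ≤ 2 ^ p := Real.rpow_le_rpow (by positivity) (by linarith) hp
      _ ≤ 2 ^ p * (1 + ‖y‖ ^ p) :=
        le_mul_of_one_le_right (by positivity) (by simp; positivity)
  · calc (1 + ‖y‖) ^ p ≤ (2 * ‖y‖) ^ p := Real.rpow_le_rpow (by positivity) (by linarith) hp
      _ = 2 ^ p * ‖y‖ ^ p := Real.mul_rpow (by norm_num) (norm_nonneg y)
      _ ≤ 2 ^ p * (1 + ‖y‖ ^ p) := by gcongr; linarith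

open scoped Pointwise in
/-- Translation and dilation of the tail integral of the kernel. -/
theorem rpow_mul_setIntegral_one_div_norm_rpow {n : ℕ} (s : ℝ) (x : En n) {r : ℝ} (hr : 0 < r) :
    r ^ (2 * s) * ∫ y in {y : En n | r ≤ ‖x - y‖}, 1 / ‖x - y‖ ^ ((n : ℝ) + 2 * s) =
      ∫ y in {y : En n | 1 ≤ ‖y‖}, 1 / ‖y‖ ^ ((n : ℝ) + 2 * s) := by
  set p : ℝ := (n : ℝ) + 2 * s with hp
  have htrans : ∫ y in {y : En n | r ≤ ‖x - y‖}, 1 / ‖x - y‖ ^ p =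
      ∫ y in {y : En n | r ≤ ‖y‖}, 1 / ‖y‖ ^ p := by
    have h0 : {y : En n | r ≤ ‖y‖} = {y : En n | r ≤ ‖0 - y‖} := by simp
    rw [← integral_indicator (measurableSet_le_norm_sub x r), h0,
      ← integral_indicator (measurableSet_le_norm_sub 0 r), ← integral_sub_left_eq_self _ volume x]
    simp [indicator]
  have hset : r • {y : En n | 1 ≤ ‖y‖} = {y : En n | r ≤ ‖y‖} := by
    ext y
    rw [mem_smul_set_iff_inv_smul_mem₀ hr.ne']
    simp [norm_smul, abs_of_pos hr, le_inv_mul_iff₀ hr]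
  have hscale := Measure.setIntegral_comp_smul_of_pos (volume : Measure (En n))
    (fun y => 1 / ‖y‖ ^ p) {y : En n | 1 ≤ ‖y‖} hr
  rw [hset] at hscale
  have hhom : ∀ y : En n, 1 / ‖r • y‖ ^ p = (r ^ p)⁻¹ * (1 / ‖y‖ ^ p) := fun y => by
    rw [norm_smul, Real.norm_of_nonneg hr.le, Real.mul_rpow hr.le (norm_nonneg y)]
    simp [mul_comm]
  simp only [hhom, integral_const_mul, finrank_euclideanSpace, Fintype.card_fin, smul_eq_mul]
    at hscale
  have hrp : r ^ p = r ^ n * r ^ (2 * s) := by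
    rw [hp, Real.rpow_add hr, Real.rpow_natCast]
  rw [hrp] at hscale
  have h1 : r ^ n ≠ 0 := by positivity
  have h2 : r ^ (2 * s) ≠ 0 := by positivity
  rw [htrans]
  field_simp at hscale
  linarith

theorem setIntegral_one_div_norm_rpow_pos {n : ℕ} (hn : 1 ≤ n) {s : ℝ} (hs : 0 < s) :
    0 < ∫ y in {y : En n | 1 ≤ ‖y‖}, 1 / ‖y‖ ^ ((n : ℝ) + 2 * s) := by
  have hint := (memL2s_one (n := n) hs).integrableOn_div_norm_rpow hs 0 one_pos
  simp only [zero_sub, norm_neg] at hint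
  rw [setIntegral_pos_iff_support_of_nonneg_ae
    (Eventually.of_forall fun y => by simp; positivity) hint]
  have hopen : IsOpen {y : En n | 1 < ‖y‖} := isOpen_lt continuous_const continuous_norm
  have hne : {y : En n | 1 < ‖y‖}.Nonempty :=
    ⟨EuclideanSpace.single ⟨0, hn⟩ 2, by simp⟩
  refine (hopen.measure_pos volume hne).trans_le (measure_mono fun y hy => ?_)
  have hy1 : 1 < ‖y‖ := hy
  have : 0 < ‖y‖ := by linarith
  exact ⟨by simp only [Function.mem_support]; positivity, hy1.le⟩

/-- Second-order necessary condition at a maximum, in a fixed direction. -/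
theorem iteratedFDeriv_two_nonpos_of_forall_le {n : ℕ} {u : En n → ℝ} (hu : ContDiff ℝ 2 u)
    {x : En n} (hmax : ∀ y, u y ≤ u x) (v : En n) :
    iteratedFDeriv ℝ 2 u x (fun _ => v) ≤ 0 := by
  have hline : ∀ t : ℝ, HasDerivAt (fun t : ℝ => x + t • v) v t := fun t => by
    simpa using ((hasDerivAt_id t).smul_const v).const_add x
  have hderiv : deriv (fun t : ℝ => u (x + t • v)) = fun t => fderiv ℝ u (x + t • v) v :=
    funext fun t => ((hu.differentiable (by norm_num) _).hasFDerivAt.comp_hasDerivAt t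
      (hline t)).deriv
  have hderiv2 : deriv (deriv fun t : ℝ => u (x + t • v)) 0 =
      iteratedFDeriv ℝ 2 u x fun _ => v := by
    have hfd : Differentiable ℝ (fderiv ℝ u) :=
      (hu.fderiv_right (m := 1) (by norm_num)).differentiable (by norm_num)
    have h : HasDerivAt (fun t : ℝ => fderiv ℝ u (x + t • v))
        (fderiv ℝ (fderiv ℝ u) (x + (0 : ℝ) • v) v) 0 :=
      (hfd _).hasFDerivAt.comp_hasDerivAt (0 : ℝ) (hline 0)
    rw [hderiv, iteratedFDeriv_two_apply, (h.clm_apply (hasDerivAt_const 0 v)).deriv]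
    simp
  by_contra! hpos
  have hmaxline : IsLocalMax (fun t : ℝ => u (x + t • v)) 0 :=
    Eventually.of_forall fun t => by simpa using hmax _
  have hmin := isLocalMin_of_deriv_deriv_pos (hderiv2.symm ▸ hpos) hmaxline.deriv_eq_zero
    (hu.continuous.comp (by fun_prop)).continuousAt
  have hconst : (fun t : ℝ => u (x + t • v)) =ᶠ[nhds 0] fun _ => u x := by
    filter_upwards [hmin] with t ht
    exact le_antisymm (hmax _) (by simpa using ht)
  have hzero := hconst.deriv.deriv_eq
  rw [hderiv2] at hzero
  simp at hzero
  exact hpos.ne' hzero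

theorem lap_nonpos_of_forall_le {n : ℕ} {u : En n → ℝ} (hu : ContDiff ℝ 2 u) {x : En n}
    (hmax : ∀ y, u y ≤ u x) : lap u x ≤ 0 :=
  Finset.sum_nonpos fun _ _ => iteratedFDeriv_two_nonpos_of_forall_le hu hmax _

theorem HasFracLap.mul_setIntegral_le {n : ℕ} {s Cns : ℝ} {u : En n → ℝ} {x : En n} {L : ℝ}
    (hL : HasFracLap n s Cns u x L) (hs : 0 < s) (hC : 0 < Cns) (hu : MemL2s n s u)
    (hmax : ∀ y, u y ≤ u x) {r : ℝ} (hr : 0 < r) :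
    Cns * (u x * (∫ y in {y : En n | r ≤ ‖x - y‖}, 1 / ‖x - y‖ ^ ((n : ℝ) + 2 * s)) -
      ∫ y in {y : En n | r ≤ ‖x - y‖}, u y / ‖x - y‖ ^ ((n : ℝ) + 2 * s)) ≤ L := by
  set p : ℝ := (n : ℝ) + 2 * s
  have hone : ∀ {ε : ℝ}, 0 < ε → IntegrableOn (fun y : En n => u x * (1 / ‖x - y‖ ^ p))
      {y | ε ≤ ‖x - y‖} := fun hε =>
    ((memL2s_one hs).integrableOn_div_norm_rpow hs x hε).const_mul _
  have hsplit : ∀ y, (u x - u y) / ‖x - y‖ ^ p =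
      u x * (1 / ‖x - y‖ ^ p) - u y / ‖x - y‖ ^ p := fun y => by ring
  rw [← integral_const_mul, ← integral_sub (hone hr) (hu.integrableOn_div_norm_rpow hs x hr)]
  rw [← integral_congr_ae (Eventually.of_forall hsplit)]
  refine ge_of_tendsto hL ?_
  filter_upwards [Ioo_mem_nhdsGT hr] with ε hε
  refine mul_le_mul_of_nonneg_left (setIntegral_mono_set ?_ ?_ ?_) hC.le
  · exact ((hone hε.1).sub (hu.integrableOn_div_norm_rpow hs x hε.1)).congr_fun
      (fun y _ => (hsplit y).symm) (measurableSet_le_norm_sub x ε)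
  · exact Eventually.of_forall fun y =>
      div_nonneg (sub_nonneg.2 (hmax y)) (Real.rpow_nonneg (norm_nonneg _) p)
  · exact LE.le.eventuallyLE fun y hy => hε.2.le.trans hy

/-- generalized average inequality for the mixed operator (elliptic case). -/
theorem average_inequality_elliptic
    (n : ℕ) (hn : 1 ≤ n) (s : ℝ) (hs : s ∈ Set.Ioo (0 : ℝ) 1)
    (Cns : ℝ) (hCns : 0 < Cns)
    (u : En n → ℝ) (huC : ContDiff ℝ 2 u) (huL : MemL2s n s u)
    (x0 : En n) (hmax : ∀ y, u y ≤ u x0)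
    (L : ℝ) (hL : HasFracLap n s Cns u x0 L)
    (C₀ : ℝ)
    (hC₀ : C₀ = (∫ y in {y : En n | 1 ≤ ‖y‖}, 1 / ‖y‖ ^ ((n : ℝ) + 2 * s))⁻¹) :
    0 < C₀ ∧
      ∀ r : ℝ, 0 < r →
        C₀ * r ^ (2 * s) *
            (∫ y in {y : En n | r ≤ ‖x0 - y‖}, 1 / ‖x0 - y‖ ^ ((n : ℝ) + 2 * s)) = 1 ∧
        u x0 ≤ C₀ / Cns * r ^ (2 * s) * (L - lap u x0) +
            C₀ * r ^ (2 * s) *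
              ∫ y in {y : En n | r ≤ ‖x0 - y‖}, u y / ‖x0 - y‖ ^ ((n : ℝ) + 2 * s) := by
  have hI := setIntegral_one_div_norm_rpow_pos hn hs.1
  have hC₀pos : 0 < C₀ := hC₀ ▸ inv_pos.2 hI
  refine ⟨hC₀pos, fun r hr => ?_⟩
  have hnorm : C₀ * r ^ (2 * s) *
      (∫ y in {y : En n | r ≤ ‖x0 - y‖}, 1 / ‖x0 - y‖ ^ ((n : ℝ) + 2 * s)) = 1 := by
    rw [mul_assoc, rpow_mul_setIntegral_one_div_norm_rpow s x0 hr, hC₀, inv_mul_cancel₀ hI.ne']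
  refine ⟨hnorm, ?_⟩
  have hle := hL.mul_setIntegral_le hs.1 hCns huL hmax hr
  have hlap := lap_nonpos_of_forall_le huC hmax
  set I := ∫ y in {y : En n | r ≤ ‖x0 - y‖}, 1 / ‖x0 - y‖ ^ ((n : ℝ) + 2 * s)
  set J := ∫ y in {y : En n | r ≤ ‖x0 - y‖}, u y / ‖x0 - y‖ ^ ((n : ℝ) + 2 * s)
  calc u x0 = C₀ / Cns * r ^ (2 * s) * (Cns * (u x0 * I - J)) + C₀ * r ^ (2 * s) * J := by
        field_simp
        linear_combination -u x0 * hnorm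
    _ ≤ C₀ / Cns * r ^ (2 * s) * (L - lap u x0) + C₀ * r ^ (2 * s) * J := by
        gcongr
        linarith
end
end

section
/- (Monotonicity in the upper half-space, elliptic.) Let n ≥ 1, s ∈ (0,1), and write ℝⁿ₊ = {x = (x', x_n) ∈ ℝⁿ : x_n > 0}. Let g : ℝ → ℝ be continuous and monotone decreasing. Let u ∈ L_{2s} ∩ C²(ℝⁿ₊) ∩ C(closure of ℝⁿ₊) be a nonnegative bounded function satisfying (−Δ)^s u(x) − Δu(x) = g(u(x)) for all x ∈ ℝⁿ₊, u(x) > 0 for all x ∈ ℝⁿ₊, and u(x) = 0 for all x ∈ ℝⁿ ∖ ℝⁿ₊. Then u is strictly increasing with respect to x_n in ℝⁿ₊: for every τ > 0 and every x = (x', x_n) ∈ ℝⁿ₊, one has u(x', x_n + τ) > u(x', x_n). -/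
open MeasureTheory Filter Set

noncomputable section

/-- Necessary second-order condition for a local minimum on the line. -/
theorem IsLocalMin.deriv_deriv_nonneg {φ : ℝ → ℝ} {t : ℝ} (h : IsLocalMin φ t)
    (hc : ContinuousAt φ t) : 0 ≤ deriv (deriv φ) t := by
  by_contra! hneg
  have hmax := isLocalMax_of_deriv_deriv_neg hneg h.deriv_eq_zero hc
  have hconst : φ =ᶠ[nhds t] fun _ => φ t := by
    filter_upwards [h, hmax] with y h1 h2 using le_antisymm h2 h1
  have h2 : deriv (deriv φ) t = 0 := by
    rw [hconst.deriv.deriv_eq]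
    simp
  linarith

/-- A function lying above a concave parabola along the line `z + ℝ e`, with contact at `z`, has
second derivative at least that of the parabola. -/
theorem neg_two_mul_le_iteratedFDeriv_two {E : Type*} [NormedAddCommGroup E] [NormedSpace ℝ E]
    {w : E → ℝ} {z e : E} {b c : ℝ} (hw : ContDiffAt ℝ 2 w z)
    (h : ∀ t : ℝ, w z ≤ w (z + t • e) + b * t + c * t ^ 2) :
    -(2 * c) ≤ iteratedFDeriv ℝ 2 w z fun _ => e := by
  have hline : ∀ t : ℝ, HasDerivAt (fun t : ℝ => z + t • e) e t := fun t => by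
    simpa using ((hasDerivAt_id t).smul_const e).const_add z
  have hcont : ContinuousAt (fun t : ℝ => z + t • e) 0 := (hline 0).continuousAt
  have hz : z + (0 : ℝ) • e = z := by simp
  have hdiff : ∀ᶠ y in nhds z, DifferentiableAt ℝ w y := by
    filter_upwards [hw.eventually (by simp)] with y hy
    exact hy.differentiableAt (by norm_num)
  have hderiv : ∀ᶠ t in nhds (0 : ℝ),
      HasDerivAt (fun t : ℝ => w (z + t • e) + b * t + c * t ^ 2)
        (fderiv ℝ w (z + t • e) e + b + c * (2 * t)) t := by
    have : ∀ᶠ t in nhds (0 : ℝ), DifferentiableAt ℝ w (z + t • e) :=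
      hcont.eventually (by simpa using hdiff)
    filter_upwards [this] with t ht
    have h1 := ht.hasFDerivAt.comp_hasDerivAt t (hline t)
    have h2 := (hasDerivAt_id t).const_mul b
    have h3 := ((hasDerivAt_id t).fun_pow 2).const_mul c
    have := (h1.fun_add h2).fun_add h3
    simpa using this
  have hmin : IsLocalMin (fun t : ℝ => w (z + t • e) + b * t + c * t ^ 2) 0 :=
    .of_forall fun t => by simpa using h t
  have hnonneg := hmin.deriv_deriv_nonneg hderiv.self_of_nhds.continuousAt
  have hEq : deriv (fun t : ℝ => w (z + t • e) + b * t + c * t ^ 2) =ᶠ[nhds 0]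
      fun t => fderiv ℝ w (z + t • e) e + b + c * (2 * t) := by
    filter_upwards [hderiv] with t ht using ht.deriv
  have hfd : DifferentiableAt ℝ (fderiv ℝ w) (z + (0 : ℝ) • e) := by
    rw [hz]
    exact (hw.fderiv_right (m := 1) (by norm_num)).differentiableAt (by norm_num)
  have hsecond : HasDerivAt (fun t : ℝ => fderiv ℝ w (z + t • e) e + b + c * (2 * t))
      (fderiv ℝ (fderiv ℝ w) z e e + c * 2) 0 := by
    have h1 : HasDerivAt (fun t : ℝ => fderiv ℝ w (z + t • e))
        (fderiv ℝ (fderiv ℝ w) z e) 0 := by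
      have := hfd.hasFDerivAt.comp_hasDerivAt (0 : ℝ) (hline 0)
      rwa [hz] at this
    have h2 : HasDerivAt (fun t : ℝ => fderiv ℝ w (z + t • e) e)
        (fderiv ℝ (fderiv ℝ w) z e e) 0 :=
      ((ContinuousLinearMap.apply ℝ ℝ e).hasFDerivAt).comp_hasDerivAt (0 : ℝ) h1
    have h3 : HasDerivAt (fun t : ℝ => c * (2 * t)) (c * 2) 0 := by
      simpa using ((hasDerivAt_id (0 : ℝ)).const_mul 2).const_mul c
    exact (h2.add_const b).fun_add h3
  rw [hEq.deriv_eq, hsecond.deriv] at hnonneg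
  rw [iteratedFDeriv_two_apply]
  linarith

/-- The kernel `‖h‖ ^ (-p)` is integrable away from the origin for `p > n`. -/
theorem integrableOn_inv_norm_rpow {n : ℕ} {p η : ℝ} (hp : (n : ℝ) < p) (hη : 0 < η) :
    IntegrableOn (fun h : En n => (‖h‖ ^ p)⁻¹) {h | η ≤ ‖h‖} := by
  have hint := (integrable_one_add_norm (μ := (volume : Measure (En n))) (r := p)
    (by simpa using hp)).const_mul ((η / (1 + η)) ^ (-p))
  have hS : MeasurableSet {h : En n | η ≤ ‖h‖} := measurableSet_le (by fun_prop) (by fun_prop)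
  refine hint.integrableOn.mono' (Measurable.aestronglyMeasurable (by fun_prop)) ?_
  filter_upwards [ae_restrict_mem hS] with h hh
  have hh : η ≤ ‖h‖ := hh
  have hpos : 0 < ‖h‖ := hη.trans_le hh
  have hp0 : 0 < p := (Nat.cast_nonneg n).trans_lt hp
  rw [Real.norm_of_nonneg (by positivity), ← Real.rpow_neg hpos.le,
    ← Real.mul_rpow (by positivity) (by positivity)]
  refine Real.rpow_le_rpow_of_nonpos (by positivity) ?_ (by linarith)
  rw [div_mul_eq_mul_div, div_le_iff₀ (by positivity)]
  nlinarith

/-- The radial profile dominating the nonlocal cost of a unit-scale paraboloid. -/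
def radialProfile (n : ℕ) (p : ℝ) (h : En n) : ℝ := min 1 (‖h‖ ^ 2) / ‖h‖ ^ p

theorem radialProfile_nonneg {n : ℕ} {p : ℝ} (h : En n) : 0 ≤ radialProfile n p h := by
  unfold radialProfile
  positivity

theorem integrable_radialProfile {n : ℕ} (hn : 1 ≤ n) {p : ℝ} (hp : (n : ℝ) < p)
    (hp' : p < (n : ℝ) + 2) : Integrable (radialProfile n p) := by
  have hmeas : Measurable (radialProfile n p) := by
    unfold radialProfile
    fun_prop
  have hnear : IntegrableOn (radialProfile n p) (Metric.ball 0 1) := by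
    refine integrableOn_ball_of_norm_le_rpow (C := 1) (α := p - 2) (by simpa using hn)
      (by simpa using by linarith) ?_ hmeas.aestronglyMeasurable
    refine .of_forall fun h => ?_
    rw [Real.norm_of_nonneg (radialProfile_nonneg h), one_mul, radialProfile]
    rcases eq_or_ne h 0 with rfl | hh
    · have : (0 : ℝ) ≤ 0 ^ (-(p - 2)) := by positivity
      simpa using this
    · have hpos : 0 < ‖h‖ := norm_pos_iff.2 hh
      rw [show -(p - 2) = ((2 : ℕ) : ℝ) - p by push_cast; ring, Real.rpow_sub hpos,
        Real.rpow_natCast]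
      gcongr
      exact min_le_right _ _
  have hfar : IntegrableOn (radialProfile n p) {h | 1 ≤ ‖h‖} := by
    refine (integrableOn_inv_norm_rpow hp one_pos).mono' hmeas.aestronglyMeasurable
      (.of_forall fun h => ?_)
    rw [Real.norm_of_nonneg (radialProfile_nonneg h), radialProfile, ← one_div]
    gcongr
    exact min_le_left _ _
  rw [← integrableOn_univ]
  refine (hnear.union hfar).mono_set fun h _ => ?_
  rcases lt_or_ge ‖h‖ 1 with h1 | h1
  · exact Or.inl (by simpa using h1)
  · exact Or.inr h1

/-- Truncated kernel integrals of bounded measurable functions converge. -/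
theorem integrableOn_div_norm_rpow {n : ℕ} {p η M : ℝ} (hp : (n : ℝ) < p) (hη : 0 < η)
    {f : En n → ℝ} (hf : Measurable f) (hM : ∀ h, |f h| ≤ M) :
    IntegrableOn (fun h => f h / ‖h‖ ^ p) {h | η ≤ ‖h‖} := by
  refine ((integrableOn_inv_norm_rpow hp hη).const_mul M).mono'
    (Measurable.aestronglyMeasurable (by fun_prop)) (.of_forall fun h => ?_)
  rw [Real.norm_eq_abs, abs_div, abs_of_nonneg (a := ‖h‖ ^ p) (by positivity), div_eq_mul_inv]
  gcongr
  exact hM h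

/-- Odd functions integrate to zero over symmetric sets. -/
theorem setIntegral_eq_zero_of_neg {n : ℕ} {S : Set (En n)} (hS : ∀ h, -h ∈ S ↔ h ∈ S)
    {f : En n → ℝ} (hf : ∀ h, f (-h) = -f h) (hSm : MeasurableSet S) : ∫ h in S, f h = 0 := by
  rw [← integral_indicator hSm]
  have h1 := integral_neg_eq_self (S.indicator f) volume
  have h2 : (fun h => S.indicator f (-h)) = fun h => -S.indicator f h := by
    ext h
    by_cases hh : h ∈ S <;> simp [indicator, hS, hf, hh]
  rw [h2, integral_neg] at h1
  linarith

/-- Unit-scale nonlocal estimate: if `f` is controlled from above by a paraboloid near `0` and by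
a constant everywhere, and is very negative on a unit ball at bounded distance, then its
truncated kernel integrals are bounded above independently of the truncation. -/
theorem setIntegral_div_norm_rpow_le {n : ℕ} (hn : 1 ≤ n) {p : ℝ} (hp : (n : ℝ) < p)
    (hp' : p < (n : ℝ) + 2) {f : En n → ℝ} (hf : Measurable f) {M : ℝ} (hM : ∀ h, |f h| ≤ M)
    {δ A : ℝ} (hδ : 0 ≤ δ) (hA : 0 ≤ A) {a b : En n} (hb : 2 ≤ ‖b‖) (hb' : ‖b‖ ≤ 4)
    (h1 : ∀ h, f h ≤ δ) (h2 : ∀ h, f h ≤ δ * (inner ℝ a h + ‖h‖ ^ 2))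
    (h3 : ∀ h ∈ Metric.ball b 1, f h ≤ -A) {η : ℝ} (hη : 0 < η) (hη' : η ≤ 1) :
    ∫ h in {h : En n | η ≤ ‖h‖}, f h / ‖h‖ ^ p ≤
      δ * (∫ h, radialProfile n p h) -
        A * ((5 ^ p)⁻¹ * volume.real (Metric.ball (0 : En n) 1)) := by
  set S : Set (En n) := {h | η ≤ ‖h‖}
  have hS : MeasurableSet S := measurableSet_le (by fun_prop) (by fun_prop)
  have hp0 : 0 < p := (Nat.cast_nonneg n).trans_lt hp
  have hballS : Metric.ball b 1 ⊆ S := fun h hh => by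
    have : ‖h - b‖ < 1 := by simpa [dist_eq_norm] using hh
    have := norm_sub_norm_le b h
    rw [norm_sub_rev] at this
    change η ≤ ‖h‖
    linarith
  set lin : En n → ℝ := (Metric.ball (0 : En n) 1).indicator fun h => inner ℝ a h
  have hlin_meas : Measurable lin := Measurable.indicator (by fun_prop) measurableSet_ball
  have hlin_bdd : ∀ h, |lin h| ≤ ‖a‖ := fun h => by
    by_cases hh : h ∈ Metric.ball (0 : En n) 1
    · have hh1 : ‖h‖ < 1 := by simpa using hh
      simp only [lin, indicator_of_mem hh]
      calc |inner ℝ a h| ≤ ‖a‖ * ‖h‖ := abs_real_inner_le_norm a h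
        _ ≤ ‖a‖ * 1 := by gcongr
        _ = ‖a‖ := mul_one _
    · simp [lin, indicator_of_notMem hh]
  have hlin_int := integrableOn_div_norm_rpow hp hη hlin_meas hlin_bdd
  have hlin_zero : ∫ h in S, lin h / ‖h‖ ^ p = 0 := by
    refine setIntegral_eq_zero_of_neg (fun h => by simp [S]) (fun h => ?_) hS
    by_cases hh : ‖h‖ < 1 <;> simp [lin, hh, neg_div]
  have hprof := integrable_radialProfile hn hp hp'
  set ind : En n → ℝ := (Metric.ball b 1).indicator fun _ => (5 ^ p)⁻¹
  have hind_int : IntegrableOn ind S :=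
    ((integrable_indicator_iff measurableSet_ball).2
      (integrableOn_const measure_ball_lt_top.ne)).integrableOn
  have hind : ∫ h in S, ind h = (5 ^ p)⁻¹ * volume.real (Metric.ball (0 : En n) 1) := by
    rw [setIntegral_indicator measurableSet_ball, inter_eq_self_of_subset_right hballS,
      setIntegral_const, smul_eq_mul, mul_comm, measureReal_def, measureReal_def,
      Measure.addHaar_ball_center]
  have hpoint : ∀ h ∈ S, f h / ‖h‖ ^ p ≤
      δ * radialProfile n p h + δ * (lin h / ‖h‖ ^ p) - A * ind h := fun h hh => by
    have hpos : 0 < ‖h‖ := hη.trans_le hh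
    have hK : 0 < ‖h‖ ^ p := by positivity
    by_cases hb1 : h ∈ Metric.ball b 1
    · have hd : ‖h - b‖ < 1 := by simpa [dist_eq_norm] using hb1
      have hl := norm_sub_norm_le b h
      rw [norm_sub_rev] at hl
      have hu := norm_sub_norm_le h b
      have hlin0 : lin h = 0 := indicator_of_notMem (by simp; linarith) _
      have hind1 : ind h = (5 ^ p)⁻¹ := indicator_of_mem hb1 _
      have h5 : (5 ^ p)⁻¹ ≤ (‖h‖ ^ p)⁻¹ := by
        gcongr
        linarith
      have hprof0 := radialProfile_nonneg (p := p) h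
      rw [hlin0, hind1, div_eq_mul_inv]
      have := h3 h hb1
      have e1 : f h * (‖h‖ ^ p)⁻¹ ≤ -A * (‖h‖ ^ p)⁻¹ := by gcongr
      have e2 : A * (5 ^ p)⁻¹ ≤ A * (‖h‖ ^ p)⁻¹ := by gcongr
      have e3 := mul_nonneg hδ hprof0
      simp only [zero_div, mul_zero]
      linarith
    · have hind0 : ind h = 0 := indicator_of_notMem hb1 _
      rw [hind0, radialProfile, mul_zero, sub_zero, ← mul_add, ← add_div, ← mul_div_assoc]
      gcongr
      by_cases h1' : ‖h‖ < 1
      · have hlin1 : lin h = inner ℝ a h := indicator_of_mem (by simpa using h1') _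
        rw [hlin1, min_eq_right (by nlinarith), add_comm]
        exact h2 h
      · have hlin0 : lin h = 0 := indicator_of_notMem (by simpa using h1') _
        rw [hlin0, min_eq_left (by nlinarith), add_zero, mul_one]
        exact h1 h
  have hprofS : ∫ h in S, radialProfile n p h ≤ ∫ h, radialProfile n p h :=
    setIntegral_le_integral hprof (.of_forall radialProfile_nonneg)
  have hint1 := (hprof.integrableOn (s := S)).const_mul δ
  have hint2 := hlin_int.const_mul δ
  have hint : IntegrableOn
      (fun h => δ * radialProfile n p h + δ * (lin h / ‖h‖ ^ p)) S := hint1.add hint2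
  calc ∫ h in S, f h / ‖h‖ ^ p
      ≤ ∫ h in S, (δ * radialProfile n p h + δ * (lin h / ‖h‖ ^ p) - A * ind h) :=
        setIntegral_mono_on (integrableOn_div_norm_rpow hp hη hf hM)
          (hint.sub (hind_int.const_mul A)) hS hpoint
    _ = δ * (∫ h in S, radialProfile n p h) -
        A * ((5 ^ p)⁻¹ * volume.real (Metric.ball (0 : En n) 1)) := by
      rw [integral_sub hint (hind_int.const_mul A), integral_add hint1 hint2,
        integral_const_mul, integral_const_mul, integral_const_mul, hlin_zero, hind]
      ring
    _ ≤ _ := by gcongr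

/-- Change of variables `y = z + r h` in the truncated fractional Laplacian. -/
theorem setIntegral_truncation_eq_scaled {n : ℕ} {s r η : ℝ} (hr : 0 < r)
    (f : En n → ℝ) (z : En n) :
    ∫ y in {y : En n | r * η ≤ ‖z - y‖}, f y / ‖z - y‖ ^ ((n : ℝ) + 2 * s) =
      r ^ (-(2 * s)) *
        ∫ h in {h : En n | η ≤ ‖h‖}, f (z + r • h) / ‖h‖ ^ ((n : ℝ) + 2 * s) := by
  have hmeas : ∀ c : ℝ, MeasurableSet {h : En n | c ≤ ‖h‖} := fun c =>
    measurableSet_le (by fun_prop) (by fun_prop)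
  have hmeas' : MeasurableSet {y : En n | r * η ≤ ‖z - y‖} :=
    measurableSet_le (by fun_prop) (by fun_prop)
  rw [← integral_indicator hmeas', ← integral_indicator (hmeas η),
    ← integral_add_left_eq_self _ z]
  have hscale := Measure.integral_comp_smul_of_nonneg (volume : Measure (En n))
    (fun h => {y : En n | r * η ≤ ‖z - y‖}.indicator
      (fun y => f y / ‖z - y‖ ^ ((n : ℝ) + 2 * s)) (z + h)) r (hR := hr.le)
  have hpt : ∀ h : En n, {y : En n | r * η ≤ ‖z - y‖}.indicator
      (fun y => f y / ‖z - y‖ ^ ((n : ℝ) + 2 * s)) (z + r • h) =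
      r ^ (-((n : ℝ) + 2 * s)) * {h : En n | η ≤ ‖h‖}.indicator
        (fun h => f (z + r • h) / ‖h‖ ^ ((n : ℝ) + 2 * s)) h := fun h => by
    have hnorm : ‖z - (z + r • h)‖ = r * ‖h‖ := by
      rw [sub_add_cancel_left, norm_neg, norm_smul, Real.norm_of_nonneg hr.le]
    by_cases hh : η ≤ ‖h‖
    · have : r * η ≤ r * ‖h‖ := by gcongr
      simp only [indicator, mem_ofPred_eq, hnorm, hh, this, if_true,
        Real.mul_rpow hr.le (norm_nonneg h), Real.rpow_neg hr.le]
      rw [div_mul_eq_div_div, div_eq_mul_inv (f (z + r • h)), div_eq_mul_inv, div_eq_mul_inv]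
      ring
    · have : ¬ r * η ≤ r * ‖h‖ := fun h' => hh (le_of_mul_le_mul_left h' hr)
      simp only [indicator, mem_ofPred_eq, hnorm, hh, this, if_false, mul_zero]
  simp only [hpt] at hscale
  rw [integral_const_mul] at hscale
  simp only [finrank_euclideanSpace, Fintype.card_fin, smul_eq_mul] at hscale
  have hrn : r ^ n * r ^ (-((n : ℝ) + 2 * s)) = r ^ (-(2 * s)) := by
    rw [← Real.rpow_natCast, ← Real.rpow_add hr]
    congr 1
    ring
  rw [← hrn, mul_assoc, hscale, mul_inv_cancel_left₀ (by positivity)]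

/-- Upper bounds on the truncated integrals pass to the fractional Laplacian. -/
theorem HasFracLap.le_of_eventually_le {n : ℕ} {s Cns L B : ℝ} {w : En n → ℝ} {z : En n}
    (hL : HasFracLap n s Cns w z L) (hC : 0 < Cns)
    (hB : ∀ᶠ ε in nhdsWithin (0 : ℝ) (Ioi 0),
      ∫ y in {y : En n | ε ≤ ‖z - y‖}, (w z - w y) / ‖z - y‖ ^ ((n : ℝ) + 2 * s) ≤ B) :
    L ≤ Cns * B :=
  le_of_tendsto hL (hB.mono fun _ h => mul_le_mul_of_nonneg_left h hC.le)

/-- Truncated integrals of a bounded measurable function, centred at an arbitrary point,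
converge. -/
theorem integrableOn_div_norm_sub_rpow {n : ℕ} {p ε M : ℝ} (hp : (n : ℝ) < p) (hε : 0 < ε)
    {f : En n → ℝ} (hf : Measurable f) (hM : ∀ y, |f y| ≤ M) (z : En n) :
    IntegrableOn (fun y => f y / ‖z - y‖ ^ p) {y | ε ≤ ‖z - y‖} := by
  have h := integrableOn_div_norm_rpow hp hε (f := fun h => f (z - h)) (by fun_prop)
    (fun h => hM _)
  have := (Measure.measurePreserving_sub_left (volume : Measure (En n)) z).integrableOn_comp_preimage
    (MeasurableEquiv.subLeft z).measurableEmbedding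
    (f := fun h => f (z - h) / ‖h‖ ^ p) (s := {h | ε ≤ ‖h‖})
  simpa [Function.comp_def] using this.2 h

/-- The fractional Laplacian of the difference between a translate and the function itself. -/
theorem HasFracLap.translate_sub {n : ℕ} {s Cns : ℝ} (hs : 0 < s) {u : En n → ℝ}
    (hu : Measurable u) {M : ℝ} (hM : ∀ y, |u y| ≤ M) {z d : En n} {L₁ L₂ : ℝ}
    (h₁ : HasFracLap n s Cns u (z + d) L₁) (h₂ : HasFracLap n s Cns u z L₂) :
    HasFracLap n s Cns (fun y => u (y + d) - u y) z (L₁ - L₂) := by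
  refine (Tendsto.sub h₁ h₂).congr' ?_
  filter_upwards [self_mem_nhdsWithin] with ε (hε : 0 < ε)
  have hp : (n : ℝ) < (n : ℝ) + 2 * s := by linarith
  have hM' : ∀ a y, |u a - u y| ≤ M + M := fun a y =>
    (abs_sub _ _).trans (add_le_add (hM a) (hM y))
  have hint₁ := integrableOn_div_norm_sub_rpow hp hε (f := fun y => u (z + d) - u (y + d))
    (by fun_prop) (fun y => hM' _ _) z
  have hint₂ := integrableOn_div_norm_sub_rpow hp hε (f := fun y => u z - u y)
    (by fun_prop) (fun y => hM' _ _) z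
  have hshift : ∫ y in {y : En n | ε ≤ ‖z + d - y‖},
        (u (z + d) - u y) / ‖z + d - y‖ ^ ((n : ℝ) + 2 * s) =
      ∫ y in {y : En n | ε ≤ ‖z - y‖},
        (u (z + d) - u (y + d)) / ‖z - y‖ ^ ((n : ℝ) + 2 * s) := by
    have := (measurePreserving_add_right (volume : Measure (En n)) d).setIntegral_preimage_emb
      (measurableEmbedding_addRight d)
      (fun y => (u (z + d) - u y) / ‖z + d - y‖ ^ ((n : ℝ) + 2 * s)) {y | ε ≤ ‖z + d - y‖}
    simpa using this.symm
  rw [hshift, ← mul_sub, ← integral_sub hint₁ hint₂]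
  congr 1
  refine integral_congr_ae (.of_forall fun y => ?_)
  change _ / _ - _ / _ = _ / _
  rw [← sub_div]
  congr 1
  ring

/-- The Laplacian of the difference between a translate and the function itself. -/
theorem lap_translate_sub {n : ℕ} {u : En n → ℝ} {z d : En n} (h₁ : ContDiffAt ℝ 2 u (z + d))
    (h₂ : ContDiffAt ℝ 2 u z) :
    lap (fun y => u (y + d) - u y) z = lap u (z + d) - lap u z := by
  have h₁' : ContDiffAt ℝ 2 (fun y => u (y + d)) z :=
    h₁.comp (f := fun y => y + d) z (contDiffAt_id.add contDiffAt_const)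
  unfold lap
  rw [← Finset.sum_sub_distrib]
  refine Finset.sum_congr rfl fun i _ => ?_
  have := iteratedFDeriv_sub_apply (i := 2) h₁' h₂
  have h : (fun y => u (y + d) - u y) = (fun y => u (y + d)) - u := rfl
  rw [h, this, iteratedFDeriv_comp_add_right]
  rfl

/-- A function above a concave paraboloid with contact at `z` has Laplacian bounded below. -/
theorem neg_le_lap {n : ℕ} {w : En n → ℝ} {z a : En n} {c : ℝ} (hw : ContDiffAt ℝ 2 w z)
    (h : ∀ k : En n, w z ≤ w (z + k) + (inner ℝ a k + c * ‖k‖ ^ 2)) :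
    -(2 * n * c) ≤ lap w z := by
  have hi : ∀ i : Fin n, -(2 * c) ≤
      iteratedFDeriv ℝ 2 w z fun _ => EuclideanSpace.single i (1 : ℝ) := fun i => by
    refine neg_two_mul_le_iteratedFDeriv_two (b := inner ℝ a (EuclideanSpace.single i (1 : ℝ)))
      hw fun t => ?_
    have := h (t • EuclideanSpace.single i (1 : ℝ))
    rw [norm_smul, inner_smul_right] at this
    simp only [PiLp.norm_single, norm_one, mul_one, Real.norm_eq_abs, sq_abs] at this
    linarith
  calc -(2 * n * c) = ∑ _i : Fin n, -(2 * c) := by simp; ring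
    _ ≤ lap w z := Finset.sum_le_sum fun i _ => hi i

/-- Strong maximum principle: a nonnegative supersolution touching zero vanishes identically. -/
theorem eq_zero_of_touches_zero {n : ℕ} {s Cns : ℝ} (hs : s ∈ Ioo (0 : ℝ) 1) (hC : 0 < Cns)
    {w : En n → ℝ} (hw : Continuous w) {M : ℝ} (hM : ∀ y, |w y| ≤ M) (h0 : ∀ y, 0 ≤ w y)
    {z : En n} (hz : w z = 0) (hz2 : ContDiffAt ℝ 2 w z) {L : ℝ}
    (hL : HasFracLap n s Cns w z L) (hsuper : 0 ≤ L - lap w z) (y : En n) : w y = 0 := by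
  by_contra hy
  have hy0 : 0 < w y := lt_of_le_of_ne (h0 y) (Ne.symm hy)
  set p : ℝ := (n : ℝ) + 2 * s
  have hp : (n : ℝ) < p := by simp only [p]; linarith [hs.1]
  have hp0 : 0 < p := (Nat.cast_nonneg n).trans_lt hp
  have hlap : 0 ≤ lap w z := by
    simpa using neg_le_lap (a := 0) (c := 0) hz2 (fun k => by simpa [hz] using h0 _)
  have hzy : 0 < ‖z - y‖ := by
    rw [norm_pos_iff, sub_ne_zero]
    rintro rfl
    exact hy hz
  obtain ⟨ρ₀, hρ₀, hball⟩ := Metric.eventually_nhds_iff_ball.1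
    (hw.continuousAt.eventually (lt_mem_nhds (half_lt_self hy0)))
  obtain ⟨ρ, hρ, hρ₀', hρz⟩ : ∃ ρ > 0, ρ ≤ ρ₀ ∧ ρ ≤ ‖z - y‖ / 2 :=
    ⟨min ρ₀ (‖z - y‖ / 2), by positivity, min_le_left _ _, min_le_right _ _⟩
  set κ : ℝ := w y / 2 / (2 * ‖z - y‖) ^ p * volume.real (Metric.ball y ρ)
  have hvol : 0 < volume.real (Metric.ball y ρ) :=
    ENNReal.toReal_pos (Metric.measure_ball_pos _ _ hρ).ne' measure_ball_lt_top.ne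
  have hκ : 0 < κ := by positivity
  have hbound : ∀ᶠ ε in nhdsWithin (0 : ℝ) (Ioi 0),
      ∫ y in {y : En n | ε ≤ ‖z - y‖}, (w z - w y) / ‖z - y‖ ^ p ≤ -κ := by
    filter_upwards [Ioo_mem_nhdsGT (half_pos hzy)] with ε hε
    have hint := integrableOn_div_norm_sub_rpow hp hε.1 hw.measurable hM z
    have hdist : ∀ q ∈ Metric.ball y ρ, ‖z - y‖ / 2 ≤ ‖z - q‖ ∧ ‖z - q‖ ≤ 2 * ‖z - y‖ :=
      fun q hq => by
        have hq : ‖q - y‖ < ρ := by simpa [dist_eq_norm] using hq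
        have e1 := norm_sub_le_norm_sub_add_norm_sub z q y
        have e2 := norm_sub_le_norm_sub_add_norm_sub z y q
        rw [norm_sub_rev y q] at e2
        constructor <;> linarith
    have hsub : Metric.ball y ρ ⊆ {q | ε ≤ ‖z - q‖} := fun q hq =>
      hε.2.le.trans (hdist q hq).1
    have hlow : κ ≤ ∫ q in Metric.ball y ρ, w q / ‖z - q‖ ^ p := by
      refine setIntegral_ge_of_const_le_real measurableSet_ball measure_ball_lt_top.ne
        (fun q hq => ?_) (hint.mono_set hsub)
      have hq1 : 0 < ‖z - q‖ := (half_pos hzy).trans_le (hdist q hq).1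
      have hq2 := (hball q (Metric.ball_subset_ball hρ₀' hq)).le
      have hq3 := (hdist q hq).2
      have := h0 q
      gcongr
    have hmono := setIntegral_mono_set hint
      (.of_forall fun q => div_nonneg (h0 q) (by positivity)) hsub.eventuallyLE
    simp only [hz, zero_sub, neg_div, integral_neg]
    linarith
  have := hL.le_of_eventually_le hC hbound
  nlinarith

/-- Maximum principle in the half-space for bounded functions under the mixed operator
`(-Δ)ˢ - Δ`. -/
theorem nonneg_of_supersolution_half_space {n : ℕ} {i₀ : Fin n} {s Cns : ℝ}
    (hs : s ∈ Ioo (0 : ℝ) 1) (hC : 0 < Cns) {w : En n → ℝ} (hw : Continuous w) {M : ℝ}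
    (hM : ∀ y, |w y| ≤ M) (hext : ∀ y, y i₀ ≤ 0 → 0 ≤ w y)
    (hint : ∀ z, 0 < z i₀ → w z < 0 →
      ContDiffAt ℝ 2 w z ∧ ∃ L, HasFracLap n s Cns w z L ∧ 0 ≤ L - lap w z) (y : En n) :
    0 ≤ w y := by
  by_contra! hy
  have hn : 1 ≤ n := (Nat.zero_le _).trans_lt i₀.isLt
  set p : ℝ := (n : ℝ) + 2 * s
  have hp : (n : ℝ) < p := by simp only [p]; linarith [hs.1]
  have hp' : p < (n : ℝ) + 2 := by simp only [p]; linarith [hs.2]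
  have hbelow : BddBelow (range w) := ⟨-M, by rintro _ ⟨q, rfl⟩; exact (abs_le.1 (hM q)).1⟩
  obtain ⟨A, hA⟩ : ∃ A, A = -⨅ q, w q := ⟨_, rfl⟩
  have hinf : ∀ q, -A ≤ w q := fun q => by
    rw [hA, neg_neg]
    exact ciInf_le hbelow q
  have hA0 : 0 < A := by linarith [hinf y]
  obtain ⟨c, hc⟩ : ∃ c, c = (5 ^ p)⁻¹ * volume.real (Metric.ball (0 : En n) 1) := ⟨_, rfl⟩
  have hvol : 0 < volume.real (Metric.ball (0 : En n) 1) :=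
    ENNReal.toReal_pos (Metric.measure_ball_pos _ _ one_pos).ne' measure_ball_lt_top.ne
  have hc0 : 0 < c := by rw [hc]; positivity
  obtain ⟨I, hI⟩ : ∃ I, I = ∫ h, radialProfile n p h := ⟨_, rfl⟩
  have hI0 : 0 ≤ I := by rw [hI]; exact integral_nonneg radialProfile_nonneg
  obtain ⟨δ, hδ0, hδA, hδ⟩ : ∃ δ > 0, δ ≤ A / 2 ∧
      δ * (Cns * I + 2 * n + 1) ≤ Cns * (A / 2 * c) := by
    have hD : 0 < Cns * I + 2 * n + 1 := by positivity
    exact ⟨min (A / 2) (Cns * (A / 2 * c) / (Cns * I + 2 * n + 1)), by positivity,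
      min_le_left _ _, (le_div_iff₀ hD).1 (min_le_right _ _)⟩
  obtain ⟨x, hx⟩ : ∃ x, w x < -A + δ := exists_lt_of_ciInf_lt (by linarith)
  have hx0 : 0 < x i₀ := by
    by_contra! h
    linarith [hext x h]
  obtain ⟨r, hr1, hrx⟩ : ∃ r : ℝ, 1 ≤ r ∧ x i₀ ≤ r :=
    ⟨max 1 (x i₀), le_max_left _ _, le_max_right _ _⟩
  have hr : 0 < r := by linarith
  obtain ⟨z, hzmem, hzmin⟩ := (isCompact_closedBall x r).exists_isMinOn
    ⟨x, Metric.mem_closedBall_self hr.le⟩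
    (f := fun q => w q + δ * ‖q - x‖ ^ 2 / r ^ 2) (by fun_prop)
  have hzx : w z + δ * ‖z - x‖ ^ 2 / r ^ 2 ≤ w x := by
    simpa using hzmin (Metric.mem_closedBall_self hr.le)
  have hglobal : ∀ q, w z + δ * ‖z - x‖ ^ 2 / r ^ 2 ≤ w q + δ * ‖q - x‖ ^ 2 / r ^ 2 :=
    fun q => by
      by_cases hq : q ∈ Metric.closedBall x r
      · exact hzmin hq
      · have hq' : r < ‖q - x‖ := by simpa [dist_eq_norm] using hq
        have : δ ≤ δ * ‖q - x‖ ^ 2 / r ^ 2 := by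
          rw [le_div_iff₀ (by positivity)]
          gcongr
        linarith [hinf q]
  have hzlt : w z < -A + δ := by
    have : 0 ≤ δ * ‖z - x‖ ^ 2 / r ^ 2 := by positivity
    linarith
  have hz0 : 0 < z i₀ := by
    by_contra! h
    linarith [hext z h]
  have hzr : z i₀ ≤ 2 * r := by
    have e1 : ‖z - x‖ ≤ r := by simpa [dist_eq_norm] using hzmem
    have e2 : |(z - x) i₀| ≤ ‖z - x‖ := PiLp.norm_apply_le (z - x) i₀
    have e3 := (abs_le.1 e2).2
    simp only [PiLp.sub_apply] at e3
    linarith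
  obtain ⟨hC2, L, hL, hsuper⟩ := hint z hz0 (by linarith)
  have hparab : ∀ k : En n,
      w z - w (z + k) ≤ δ / r ^ 2 * (2 * inner ℝ (z - x) k + ‖k‖ ^ 2) := fun k => by
    have h := hglobal (z + k)
    have e : ‖z + k - x‖ ^ 2 = ‖z - x‖ ^ 2 + (2 * inner ℝ (z - x) k + ‖k‖ ^ 2) := by
      rw [add_sub_right_comm, norm_add_sq_real]
      ring
    rw [e, mul_add, add_div] at h
    rw [div_mul_eq_mul_div]
    linarith
  have hlap : -(2 * n * (δ / r ^ 2)) ≤ lap w z := by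
    refine neg_le_lap (a := (2 * (δ / r ^ 2)) • (z - x)) hC2 fun k => ?_
    have := hparab k
    rw [real_inner_smul_left]
    linarith
  set b : En n := (-(z i₀ / r + 2)) • eDir i₀
  have hb : ‖b‖ = z i₀ / r + 2 := by
    simp only [b, eDir, norm_smul, PiLp.norm_single, norm_one, mul_one, norm_neg]
    exact Real.norm_of_nonneg (by positivity)
  have hbound : ∀ᶠ ε in nhdsWithin (0 : ℝ) (Ioi 0),
      ∫ q in {q : En n | ε ≤ ‖z - q‖}, (w z - w q) / ‖z - q‖ ^ p ≤
        r ^ (-(2 * s)) * (δ * I - A / 2 * c) := by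
    filter_upwards [Ioo_mem_nhdsGT hr] with ε hε
    have hscale := setIntegral_truncation_eq_scaled (s := s) (η := ε / r) hr
      (fun q => w z - w q) z
    rw [mul_div_cancel₀ _ hr.ne'] at hscale
    rw [hscale, hI, hc]
    refine mul_le_mul_of_nonneg_left ?_ (by positivity)
    refine setIntegral_div_norm_rpow_le (M := M + M) (a := (2 / r) • (z - x)) (b := b) hn hp hp'
      (by fun_prop) (fun h => (abs_sub _ _).trans (add_le_add (hM _) (hM _))) hδ0.le
      (by positivity) ?_ ?_ (fun h => ?_) (fun h => ?_) (fun h hh => ?_) (div_pos hε.1 hr)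
      ((div_le_one hr).2 hε.2.le)
    · rw [hb]
      have := div_nonneg hz0.le hr.le
      linarith
    · rw [hb]
      have := (div_le_iff₀ hr).2 hzr
      linarith
    · linarith [hinf (z + r • h)]
    · refine (hparab (r • h)).trans_eq ?_
      rw [real_inner_smul_left, real_inner_smul_right, norm_smul, Real.norm_of_nonneg hr.le]
      field_simp
    · have e1 : ‖h - b‖ < 1 := by simpa [dist_eq_norm] using hh
      have e2 : |(h - b) i₀| ≤ ‖h - b‖ := PiLp.norm_apply_le (h - b) i₀
      have e3 := (abs_le.1 e2).2
      have e4 : b i₀ = -(z i₀ / r + 2) := by simp [b, eDir]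
      rw [PiLp.sub_apply, e4] at e3
      have e5 : (z + r • h) i₀ ≤ 0 := by
        have e6 : r * h i₀ ≤ r * (-(z i₀ / r) - 1) := by
          gcongr
          linarith
        have e7 : r * (-(z i₀ / r) - 1) = -z i₀ - r := by field_simp
        simp only [PiLp.add_apply, PiLp.smul_apply, smul_eq_mul]
        linarith
      linarith [hext _ e5]
  have hLle := hL.le_of_eventually_le hC hbound
  have hpow : 1 / r ^ 2 ≤ r ^ (-(2 * s)) := by
    rw [one_div, ← Real.rpow_natCast, ← Real.rpow_neg hr.le]
    exact Real.rpow_le_rpow_of_exponent_le hr1 (by push_cast; linarith [hs.2])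
  have hR : 0 < r ^ (-(2 * s)) := by positivity
  have hlap' : -(2 * n * δ * r ^ (-(2 * s))) ≤ lap w z := by
    refine le_trans ?_ hlap
    have : 2 * n * δ * (1 / r ^ 2) ≤ 2 * n * δ * r ^ (-(2 * s)) := by gcongr
    have e : 2 * n * (δ / r ^ 2) = 2 * n * δ * (1 / r ^ 2) := by ring
    linarith
  have hfinal : r ^ (-(2 * s)) * (Cns * (δ * I - A / 2 * c) + 2 * n * δ) < 0 :=
    mul_neg_of_pos_of_neg hR (by nlinarith)
  linarith

/-- monotonicity in the upper half-space for the mixed operator (elliptic). -/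
theorem monotonicity_half_space_elliptic
    (n : ℕ) (hn : 1 ≤ n) (i₀ : Fin n) (hi₀ : (i₀ : ℕ) = n - 1)
    (s : ℝ) (hs : s ∈ Set.Ioo (0 : ℝ) 1) (Cns : ℝ) (hCns : 0 < Cns)
    (g : ℝ → ℝ) (hgc : Continuous g) (hga : Antitone g)
    (u : En n → ℝ) (huL : MemL2s n s u)
    (huC : ContDiffOn ℝ 2 u {x : En n | 0 < x i₀})
    (huCont : ContinuousOn u (closure {x : En n | 0 < x i₀}))
    (hnonneg : ∀ x, 0 ≤ u x) (hbdd : ∃ M : ℝ, ∀ x, u x ≤ M)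
    (Lu : En n → ℝ) (hLu : ∀ x ∈ {x : En n | 0 < x i₀}, HasFracLap n s Cns u x (Lu x))
    (heq : ∀ x ∈ {x : En n | 0 < x i₀}, Lu x - lap u x = g (u x))
    (hpos : ∀ x ∈ {x : En n | 0 < x i₀}, 0 < u x)
    (hzero : ∀ x ∉ {x : En n | 0 < x i₀}, u x = 0) :
    ∀ τ : ℝ, 0 < τ → ∀ x ∈ {x : En n | 0 < x i₀}, u x < u (x + τ • eDir i₀) := by
  have hcont : Continuous u := by
    have hclosed : IsClosed {x : En n | x i₀ ≤ 0} := isClosed_le (by fun_prop) continuous_const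
    have hcover : closure {x : En n | 0 < x i₀} ∪ {x : En n | x i₀ ≤ 0} = univ :=
      eq_univ_of_forall fun x => (lt_or_ge 0 (x i₀)).imp (fun h => subset_closure h) id
    rw [← continuousOn_univ, ← hcover]
    refine huCont.union_of_isClosed ?_ isClosed_closure hclosed
    exact continuousOn_const.congr fun x (hx : x i₀ ≤ 0) => hzero x (not_lt.2 hx)
  have hopen : IsOpen {x : En n | 0 < x i₀} := isOpen_lt continuous_const (by fun_prop)
  obtain ⟨M, hM⟩ := hbdd
  have habs : ∀ y, |u y| ≤ M := fun y => by rw [abs_of_nonneg (hnonneg y)]; exact hM y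
  intro τ hτ x hx
  set d : En n := τ • eDir i₀
  have hd : d i₀ = τ := by simp [d, eDir]
  have hshift : ∀ z : En n, 0 < z i₀ → 0 < (z + d) i₀ := fun z hz => by
    rw [PiLp.add_apply, hd]
    positivity
  have hwcont : Continuous fun y => u (y + d) - u y := by fun_prop
  have hwbdd : ∀ y, |u (y + d) - u y| ≤ M + M := fun y =>
    (abs_sub _ _).trans (add_le_add (habs _) (habs _))
  have hwsmooth : ∀ z : En n, 0 < z i₀ → ContDiffAt ℝ 2 (fun y => u (y + d) - u y) z :=
    fun z hz => by
      have h1 := huC.contDiffAt (hopen.mem_nhds (hshift z hz))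
      have h2 := huC.contDiffAt (hopen.mem_nhds hz)
      exact (h1.comp (f := fun y => y + d) z (contDiffAt_id.add contDiffAt_const)).sub h2
  have hweq : ∀ z : En n, 0 < z i₀ →
      HasFracLap n s Cns (fun y => u (y + d) - u y) z (Lu (z + d) - Lu z) ∧
      Lu (z + d) - Lu z - lap (fun y => u (y + d) - u y) z = g (u (z + d)) - g (u z) :=
    fun z hz => by
      refine ⟨(hLu _ (hshift z hz)).translate_sub hs.1 hcont.measurable habs (hLu z hz), ?_⟩
      rw [lap_translate_sub (huC.contDiffAt (hopen.mem_nhds (hshift z hz)))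
        (huC.contDiffAt (hopen.mem_nhds hz)), ← heq _ (hshift z hz), ← heq z hz]
      ring
  have hweak : ∀ y, 0 ≤ u (y + d) - u y :=
    nonneg_of_supersolution_half_space hs hCns hwcont hwbdd
      (fun y hy => by
        rw [hzero y (not_lt.2 hy), sub_zero]
        exact hnonneg _)
      fun z hz hneg => ⟨hwsmooth z hz, _, (hweq z hz).1, by
        rw [(hweq z hz).2]
        exact sub_nonneg.2 (hga (by linarith))⟩
  refine lt_of_le_of_ne (sub_nonneg.1 (hweak x)) fun hEq => ?_
  have hvanish := eq_zero_of_touches_zero hs hCns hwcont hwbdd hweak (sub_eq_zero.2 hEq.symm)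
    (hwsmooth x hx) (hweq x hx).1 (by rw [(hweq x hx).2, hEq, sub_self]) 0
  have h0 : u 0 = 0 := hzero 0 (by simp)
  have hd0 : 0 < u d := hpos d (by simpa [hd] using hτ)
  rw [zero_add, h0, sub_zero] at hvanish
  exact hd0.ne' hvanish
end
end
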